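/- arXiv:2203.03220 — 2 statements merged into one kernel-verified Lean document; each statement's English description precedes it below -/
import Mathlib

section
/- For every u ∈ (0,1), the inverse standard normal CDF is differentiable with derivative (Φ^{-1})'(u) = √(2π) · exp( (Φ^{-1}(u))² / 2 ), and this derivative satisfies the bound (Φ^{-1})'(u) ≤ √(2π) / min(u, 1−u). Moreover, for u ∈ (0, 1/2] one has exp( (Φ^{-1}(u))² / 2 ) ≤ 1/u, and for u ∈ (1/2, 1) one has exp( (Φ^{-1}(u))² / 2 ) ≤ 1/(1−u). -/
open MeasureTheory Filter

/-- The standard normal CDF `Φ(t) = ∫_{-∞}^t (2π)^{-1/2} e^{-s²/2} ds`. -/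
noncomputable def stdNormalCDF (t : ℝ) : ℝ :=
  ∫ s in Set.Iic t, (Real.sqrt (2 * Real.pi))⁻¹ * Real.exp (-s ^ 2 / 2)

/-- The mixed partial derivative `D_v f` of `f : ℝ^d → ℝ`, taken exactly once with
respect to each coordinate `z_i` with `i ∈ v` (and `D_∅ f = f`). -/
noncomputable def mixedPartial {d : ℕ} (f : (Fin d → ℝ) → ℝ) (v : Finset (Fin d)) :
    (Fin d → ℝ) → ℝ :=
  fun z => iteratedFDeriv ℝ v.card f z
    (fun j => Pi.single ((v.sort (· ≤ ·)).get ⟨j.1, by simp⟩) 1)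

/-- `G : ℝ^d → ℝ` satisfies the QMC-friendly boundary growth condition if for every tuple
of positive reals `(B_1, …, B_d)` there is a constant `B < ∞` with
`|(D_v G)(z)| ≤ B ∏_i (1 - Φ(|z_i|))^{-B_i}` for all `z` and all `v ⊆ {1,…,d}`. -/
def BoundaryGrowthCondition {d : ℕ} (G : (Fin d → ℝ) → ℝ) : Prop :=
  ∀ B : Fin d → ℝ, (∀ i, 0 < B i) →
    ∃ C : ℝ, ∀ (v : Finset (Fin d)) (z : Fin d → ℝ),
      |mixedPartial G v z| ≤ C * ∏ i, (1 - stdNormalCDF |z i|) ^ (-(B i))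

/-- `Φ⁻¹ : (0,1) → ℝ`, the inverse of the standard normal CDF. -/
noncomputable def probit : ℝ → ℝ := Function.invFun stdNormalCDF

open ProbabilityTheory Topology

lemma stdNormal_density_eq_gaussianPDFReal (s : ℝ) :
    (Real.sqrt (2 * Real.pi))⁻¹ * Real.exp (-s ^ 2 / 2) = gaussianPDFReal 0 1 s := by
  simp [gaussianPDFReal]

lemma stdNormalCDF_eq_setIntegral (t : ℝ) :
    stdNormalCDF t = ∫ s in Set.Iic t, gaussianPDFReal 0 1 s := by
  simp only [stdNormalCDF, stdNormal_density_eq_gaussianPDFReal]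

lemma stdNormalCDF_eq_measureReal (t : ℝ) :
    stdNormalCDF t = (gaussianReal 0 1).real (Set.Iic t) := by
  rw [stdNormalCDF_eq_setIntegral, Measure.real, gaussianReal_apply_eq_integral 0 one_ne_zero,
    ENNReal.toReal_ofReal (integral_nonneg fun x => gaussianPDFReal_nonneg 0 1 x)]

lemma stdNormalCDF_eq_cdf : stdNormalCDF = cdf (gaussianReal 0 1) := by
  funext t
  rw [stdNormalCDF_eq_measureReal, cdf_eq_real]

lemma stdNormalCDF_neg (t : ℝ) : stdNormalCDF (-t) = 1 - stdNormalCDF t := by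
  have hint := integrable_gaussianPDFReal 0 1
  have hadd := intervalIntegral.integral_Iic_add_Ioi (b := t) hint.integrableOn hint.integrableOn
  rw [integral_gaussianPDFReal_eq_one 0 one_ne_zero] at hadd
  have hneg := integral_comp_neg_Iic (-t) (gaussianPDFReal 0 1)
  have heven : ∀ x, gaussianPDFReal 0 1 (-x) = gaussianPDFReal 0 1 x := by
    simp [gaussianPDFReal]
  simp only [heven, neg_neg] at hneg
  rw [stdNormalCDF_eq_setIntegral, stdNormalCDF_eq_setIntegral]
  linarith

lemma hasDerivAt_stdNormalCDF (t : ℝ) :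
    HasDerivAt stdNormalCDF ((Real.sqrt (2 * Real.pi))⁻¹ * Real.exp (-t ^ 2 / 2)) t := by
  have hint := integrable_gaussianPDFReal 0 1
  have hcont : Continuous (gaussianPDFReal 0 1) := by
    simp only [gaussianPDFReal_def]
    fun_prop
  have hd : HasDerivAt (fun x => ∫ s in (0 : ℝ)..x, gaussianPDFReal 0 1 s)
      (gaussianPDFReal 0 1 t) t :=
    intervalIntegral.integral_hasDerivAt_right hint.intervalIntegrable
      hcont.stronglyMeasurable.stronglyMeasurableAtFilter hcont.continuousAt
  rw [stdNormal_density_eq_gaussianPDFReal]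
  refine (hd.const_add (stdNormalCDF 0)).congr_of_eventuallyEq (Eventually.of_forall fun x => ?_)
  have := intervalIntegral.integral_Iic_sub_Iic (a := 0) (b := x)
    hint.integrableOn hint.integrableOn
  simp only [stdNormalCDF_eq_setIntegral]
  linarith

lemma strictMono_stdNormalCDF : StrictMono stdNormalCDF :=
  strictMono_of_deriv_pos fun t => by
    rw [(hasDerivAt_stdNormalCDF t).deriv]
    positivity

lemma continuous_stdNormalCDF : Continuous stdNormalCDF :=
  continuous_iff_continuousAt.2 fun t => (hasDerivAt_stdNormalCDF t).continuousAt

lemma stdNormalCDF_mem_Ioo (t : ℝ) : stdNormalCDF t ∈ Set.Ioo (0 : ℝ) 1 := by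
  have hlt := strictMono_stdNormalCDF (sub_one_lt t)
  have hgt := strictMono_stdNormalCDF (lt_add_one t)
  rw [stdNormalCDF_eq_cdf] at *
  exact ⟨(cdf_nonneg _ _).trans_lt hlt, hgt.trans_le (cdf_le_one _ _)⟩

lemma stdNormalCDF_probit {u : ℝ} (hu : u ∈ Set.Ioo (0 : ℝ) 1) :
    stdNormalCDF (probit u) = u := by
  refine Function.invFun_eq ?_
  have hbot : Tendsto stdNormalCDF atBot (𝓝 0) := stdNormalCDF_eq_cdf ▸ tendsto_cdf_atBot _
  have htop : Tendsto stdNormalCDF atTop (𝓝 1) := stdNormalCDF_eq_cdf ▸ tendsto_cdf_atTop _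
  exact mem_range_of_exists_le_of_exists_ge continuous_stdNormalCDF
    ((hbot.eventually_le_const hu.1).exists) ((htop.eventually_const_le hu.2).exists)

lemma probit_stdNormalCDF (t : ℝ) : probit (stdNormalCDF t) = t :=
  Function.leftInverse_invFun strictMono_stdNormalCDF.injective t

lemma strictMonoOn_probit : StrictMonoOn probit (Set.Ioo 0 1) := by
  intro u hu v hv huv
  rwa [← strictMono_stdNormalCDF.lt_iff_lt, stdNormalCDF_probit hu, stdNormalCDF_probit hv]

lemma image_probit_Ioo : probit '' Set.Ioo 0 1 = Set.univ :=
  Set.eq_univ_of_forall fun t => ⟨stdNormalCDF t, stdNormalCDF_mem_Ioo t, probit_stdNormalCDF t⟩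

lemma continuousAt_probit {u : ℝ} (hu : u ∈ Set.Ioo (0 : ℝ) 1) : ContinuousAt probit u :=
  strictMonoOn_probit.continuousAt_of_image_mem_nhds (isOpen_Ioo.mem_nhds hu)
    (image_probit_Ioo ▸ univ_mem)

lemma hasDerivAt_probit {u : ℝ} (hu : u ∈ Set.Ioo (0 : ℝ) 1) :
    HasDerivAt probit (Real.sqrt (2 * Real.pi) * Real.exp ((probit u) ^ 2 / 2)) u := by
  have h := (hasDerivAt_stdNormalCDF (probit u)).of_local_left_inverse (continuousAt_probit hu)
    (by positivity)
    (eventually_of_mem (isOpen_Ioo.mem_nhds hu) fun v hv => stdNormalCDF_probit hv)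
  rwa [mul_inv, inv_inv, ← Real.exp_neg, neg_div, neg_neg] at h

/-- The Chernoff bound for the lower tail of the standard normal distribution. -/
lemma stdNormalCDF_le_exp {t : ℝ} (ht : t ≤ 0) : stdNormalCDF t ≤ Real.exp (-(t ^ 2 / 2)) := by
  have h := measure_le_le_exp_mul_mgf (μ := gaussianReal 0 1) (X := id) t ht
    (integrable_exp_mul_gaussianReal t)
  rw [mgf_id_gaussianReal, ← Real.exp_add] at h
  rw [stdNormalCDF_eq_measureReal]
  refine h.trans_eq ?_
  congr 1
  push_cast
  ring

lemma exp_sq_half_le_one_div_stdNormalCDF {t : ℝ} (ht : t ≤ 0) :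
    Real.exp (t ^ 2 / 2) ≤ 1 / stdNormalCDF t := by
  rw [le_one_div (Real.exp_pos _) (stdNormalCDF_mem_Ioo t).1, one_div, ← Real.exp_neg]
  exact stdNormalCDF_le_exp ht

lemma stdNormalCDF_zero : stdNormalCDF 0 = 1 / 2 := by
  have h := stdNormalCDF_neg 0
  rw [neg_zero] at h
  linarith

/-- for `u ∈ (0,1)`, `Φ⁻¹` is differentiable with derivative
`√(2π) exp((Φ⁻¹(u))²/2)`, which is bounded by `√(2π)/min(u, 1-u)`; moreover
`exp((Φ⁻¹(u))²/2) ≤ 1/u` for `u ∈ (0,1/2]` and `≤ 1/(1-u)` for `u ∈ (1/2,1)`. -/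
theorem probit_hasDerivAt_and_bounds (u : ℝ) (hu : u ∈ Set.Ioo (0 : ℝ) 1) :
    HasDerivAt probit (Real.sqrt (2 * Real.pi) * Real.exp ((probit u) ^ 2 / 2)) u ∧
    Real.sqrt (2 * Real.pi) * Real.exp ((probit u) ^ 2 / 2) ≤
      Real.sqrt (2 * Real.pi) / min u (1 - u) ∧
    (u ≤ 1 / 2 → Real.exp ((probit u) ^ 2 / 2) ≤ 1 / u) ∧
    (1 / 2 < u → Real.exp ((probit u) ^ 2 / 2) ≤ 1 / (1 - u)) := by
  have hΦ := stdNormalCDF_probit hu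
  have hlower : u ≤ 1 / 2 → Real.exp ((probit u) ^ 2 / 2) ≤ 1 / u := by
    intro h
    have ht : probit u ≤ 0 := by
      rwa [← strictMono_stdNormalCDF.le_iff_le, hΦ, stdNormalCDF_zero]
    simpa only [hΦ] using exp_sq_half_le_one_div_stdNormalCDF ht
  have hupper : 1 / 2 < u → Real.exp ((probit u) ^ 2 / 2) ≤ 1 / (1 - u) := by
    intro h
    have ht : 0 < probit u := by
      rwa [← strictMono_stdNormalCDF.lt_iff_lt, hΦ, stdNormalCDF_zero]
    simpa only [stdNormalCDF_neg, hΦ, neg_sq] using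
      exp_sq_half_le_one_div_stdNormalCDF (neg_nonpos.2 ht.le)
  refine ⟨hasDerivAt_probit hu, ?_, hlower, hupper⟩
  rw [div_eq_mul_one_div (Real.sqrt (2 * Real.pi)) (min u (1 - u))]
  refine mul_le_mul_of_nonneg_left ?_ (Real.sqrt_nonneg _)
  rcases le_or_gt u (1 / 2) with h | h
  · rw [min_eq_left (by linarith)]
    exact hlower h
  · rw [min_eq_right (by linarith)]
    exact hupper h
end

section
/- Fix η > 0 and define the smooth positivization function v₊ : ℝ → ℝ by v₊(t) = t/2 + √(η + t²/4). If G̃ : ℝ^d → ℝ is a smooth function satisfying the QMC-friendly boundary growth condition, then the composition H(z) = v₊(G̃(z)) is smooth and also satisfies the QMC-friendly boundary growth condition. (Key facts used: every derivative v₊^{(k)} with k ≥ 1 is bounded on ℝ, and 0 < v₊(t) ≤ √(4η + t²) for all t ∈ ℝ.) -/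
open MeasureTheory Filter

/-- The smooth positivization `v₊(t) = t/2 + √(η + t²/4)`. -/
noncomputable def vplus (η t : ℝ) : ℝ := t / 2 + Real.sqrt (η + t ^ 2 / 4)

open scoped ContDiff

section NormalTail

lemma stdNormalCDF_eq_setIntegral_gaussianPDFReal (t : ℝ) :
    stdNormalCDF t = ∫ s in Set.Iic t, ProbabilityTheory.gaussianPDFReal 0 1 s := by
  simp [stdNormalCDF, ProbabilityTheory.gaussianPDFReal]

lemma stdNormalCDF_nonneg (t : ℝ) : 0 ≤ stdNormalCDF t := by
  unfold stdNormalCDF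
  positivity

lemma stdNormalCDF_lt_one (t : ℝ) : stdNormalCDF t < 1 := by
  have hint := ProbabilityTheory.integrable_gaussianPDFReal 0 1
  have hsum := integral_add_compl (measurableSet_Iic (a := t)) hint
  rw [ProbabilityTheory.integral_gaussianPDFReal_eq_one 0 one_ne_zero, Set.compl_Iic,
    ← stdNormalCDF_eq_setIntegral_gaussianPDFReal] at hsum
  have hpos : 0 < ∫ s in Set.Ioi t, ProbabilityTheory.gaussianPDFReal 0 1 s := by
    rw [setIntegral_pos_iff_support_of_nonneg_ae
      (ae_of_all _ fun s => ProbabilityTheory.gaussianPDFReal_nonneg 0 1 s) hint.integrableOn]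
    have hsupp : Function.support (ProbabilityTheory.gaussianPDFReal 0 1) = Set.univ :=
      Set.eq_univ_of_forall fun s =>
        (ProbabilityTheory.gaussianPDFReal_pos 0 1 s one_ne_zero).ne'
    simp [hsupp]
  linarith

variable {d : ℕ}

lemma one_le_prod_normalTail_rpow {B : Fin d → ℝ} (hB : ∀ i, 0 < B i) (z : Fin d → ℝ) :
    1 ≤ ∏ i, (1 - stdNormalCDF |z i|) ^ (-(B i)) := by
  refine Finset.one_le_prod fun i _ => ?_
  have h₀ := stdNormalCDF_nonneg |z i|
  have h₁ := stdNormalCDF_lt_one |z i|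
  exact Real.one_le_rpow_of_pos_of_le_one_of_nonpos (by linarith) (by linarith)
    (by linarith [hB i])

lemma prod_normalTail_rpow_half_mul_self (B : Fin d → ℝ) (z : Fin d → ℝ) :
    (∏ i, (1 - stdNormalCDF |z i|) ^ (-(B i / 2))) *
      (∏ i, (1 - stdNormalCDF |z i|) ^ (-(B i / 2))) =
      ∏ i, (1 - stdNormalCDF |z i|) ^ (-(B i)) := by
  rw [← Finset.prod_mul_distrib]
  refine Finset.prod_congr rfl fun i _ => ?_
  rw [← Real.rpow_add (by linarith [stdNormalCDF_lt_one |z i|])]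
  congr 1
  ring

end NormalTail

section SlowGrowth

variable {d : ℕ}

/-- `F` is dominated by every weight `C ∏_i (1 - Φ(|z_i|))^{-B_i}` with positive exponents. -/
def SlowGrowth (F : (Fin d → ℝ) → ℝ) : Prop :=
  ∀ B : Fin d → ℝ, (∀ i, 0 < B i) →
    ∃ C : ℝ, ∀ z : Fin d → ℝ, |F z| ≤ C * ∏ i, (1 - stdNormalCDF |z i|) ^ (-(B i))

lemma SlowGrowth.mono {F H : (Fin d → ℝ) → ℝ} (hF : SlowGrowth F) (h : ∀ z, |H z| ≤ |F z|) :
    SlowGrowth H := fun B hB =>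
  (hF B hB).imp fun _ hC z => (h z).trans (hC z)

lemma SlowGrowth.const (c : ℝ) : SlowGrowth (fun _ : Fin d → ℝ => c) := fun _ hB =>
  ⟨|c|, fun z => le_mul_of_one_le_right (abs_nonneg c) (one_le_prod_normalTail_rpow hB z)⟩

lemma SlowGrowth.abs {F : (Fin d → ℝ) → ℝ} (hF : SlowGrowth F) :
    SlowGrowth (fun z => |F z|) :=
  hF.mono fun z => (abs_abs (F z)).le

lemma SlowGrowth.add {F H : (Fin d → ℝ) → ℝ} (hF : SlowGrowth F) (hH : SlowGrowth H) :
    SlowGrowth (fun z => F z + H z) := by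
  intro B hB
  obtain ⟨C, hC⟩ := hF B hB
  obtain ⟨K, hK⟩ := hH B hB
  refine ⟨C + K, fun z => (abs_add_le _ _).trans ?_⟩
  rw [add_mul]
  exact add_le_add (hC z) (hK z)

lemma SlowGrowth.mul {F H : (Fin d → ℝ) → ℝ} (hF : SlowGrowth F) (hH : SlowGrowth H) :
    SlowGrowth (fun z => F z * H z) := by
  intro B hB
  have hB' : ∀ i, 0 < B i / 2 := fun i => half_pos (hB i)
  obtain ⟨C, hC⟩ := hF (fun i => B i / 2) hB'
  obtain ⟨K, hK⟩ := hH (fun i => B i / 2) hB'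
  refine ⟨C * K, fun z => ?_⟩
  rw [abs_mul, ← prod_normalTail_rpow_half_mul_self, mul_mul_mul_comm]
  exact mul_le_mul (hC z) (hK z) (abs_nonneg _) ((abs_nonneg _).trans (hC z))

lemma boundaryGrowthCondition_iff_slowGrowth {F : (Fin d → ℝ) → ℝ} :
    BoundaryGrowthCondition F ↔ ∀ v, SlowGrowth (mixedPartial F v) := by
  refine ⟨fun h v B hB => (h B hB).imp fun _ hC => hC v, fun h B hB => ?_⟩
  choose C hC using fun v => h v B hB
  refine ⟨∑ v, |C v|, fun v z => (hC v z).trans ?_⟩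
  refine mul_le_mul_of_nonneg_right ?_
    (zero_le_one.trans (one_le_prod_normalTail_rpow hB z))
  exact (le_abs_self _).trans
    (Finset.single_le_sum (f := fun v => |C v|) (fun _ _ => abs_nonneg _) (Finset.mem_univ v))

end SlowGrowth

section MixedPartial

variable {d : ℕ}

/-- The partial derivative of `F` in the direction of the coordinate `a`. -/
noncomputable def coordDeriv (a : Fin d) (F : (Fin d → ℝ) → ℝ) : (Fin d → ℝ) → ℝ :=
  fun z => fderiv ℝ F z (Pi.single a 1)

lemma contDiff_coordDeriv {F : (Fin d → ℝ) → ℝ} (hF : ContDiff ℝ ∞ F) (a : Fin d) :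
    ContDiff ℝ ∞ (coordDeriv a F) :=
  (hF.fderiv_right (m := ∞) (by simp)).clm_apply contDiff_const

lemma coordDeriv_mul {F H : (Fin d → ℝ) → ℝ} (hF : ContDiff ℝ ∞ F) (hH : ContDiff ℝ ∞ H)
    (a : Fin d) :
    coordDeriv a (fun z => F z * H z) =
      fun z => F z * coordDeriv a H z + coordDeriv a F z * H z := by
  ext z
  have hF' : DifferentiableAt ℝ F z := hF.differentiable (by simp) z
  have hH' : DifferentiableAt ℝ H z := hH.differentiable (by simp) z
  simp [coordDeriv, fderiv_fun_mul hF' hH', mul_comm]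

lemma coordDeriv_comp {f : ℝ → ℝ} {f' : ℝ → ℝ} (hf : ∀ t, HasDerivAt f (f' t) t)
    {G : (Fin d → ℝ) → ℝ} (hG : ContDiff ℝ ∞ G) (a : Fin d) :
    coordDeriv a (fun z => f (G z)) = fun z => f' (G z) * coordDeriv a G z := by
  ext z
  have hG' : DifferentiableAt ℝ G z := hG.differentiable (by simp) z
  have h := ((hf (G z)).comp_hasFDerivAt z hG'.hasFDerivAt).fderiv
  simp only [Function.comp_def] at h
  simp [coordDeriv, h]

lemma mixedPartial_empty (F : (Fin d → ℝ) → ℝ) : mixedPartial F ∅ = F := by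
  ext z
  exact iteratedFDeriv_zero_apply _

lemma mixedPartial_add {F H : (Fin d → ℝ) → ℝ} (hF : ContDiff ℝ ∞ F) (hH : ContDiff ℝ ∞ H)
    (v : Finset (Fin d)) :
    mixedPartial (fun z => F z + H z) v = fun z => mixedPartial F v z + mixedPartial H v z := by
  ext z
  have hle : ((v.card : ℕ∞) : WithTop ℕ∞) ≤ ∞ := by exact_mod_cast le_top
  simp [mixedPartial, fun_iteratedFDeriv_add_apply (hF.of_le hle).contDiffAt
    (hH.of_le hle).contDiffAt]

lemma mixedPartial_eq_of_sort_eq (F : (Fin d → ℝ) → ℝ) {v : Finset (Fin d)} {n : ℕ}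
    {l : List (Fin d)} (hl : v.sort (· ≤ ·) = l) (hn : n = l.length) (z : Fin d → ℝ) :
    mixedPartial F v z =
      iteratedFDeriv ℝ n F z (fun j => Pi.single (l.get (j.cast hn)) 1) := by
  subst hl
  obtain rfl : n = v.card := by simpa using hn
  rfl

lemma sort_insert_max {v : Finset (Fin d)} {a : Fin d} (ha : ∀ b ∈ v, b < a) :
    (insert a v).sort (· ≤ ·) = v.sort (· ≤ ·) ++ [a] := by
  have hav : a ∉ v := fun h => lt_irrefl a (ha a h)
  refine List.Perm.eq_of_pairwise' (r := (· ≤ ·)) (Finset.pairwise_sort _ _) ?_ ?_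
  · rw [List.pairwise_append]
    refine ⟨Finset.pairwise_sort _ _, List.pairwise_singleton _ _, fun b hb c hc => ?_⟩
    obtain rfl := List.mem_singleton.1 hc
    exact (ha b ((Finset.mem_sort _).1 hb)).le
  · refine ((Finset.sort_perm_toList _ _).trans (Finset.toList_insert hav)).trans ?_
    exact ((Finset.sort_perm_toList v (· ≤ ·)).symm.cons a).trans
      (List.perm_append_singleton a _).symm

lemma mixedPartial_insert_max {F : (Fin d → ℝ) → ℝ} (hF : ContDiff ℝ ∞ F)
    {v : Finset (Fin d)} {a : Fin d} (ha : ∀ b ∈ v, b < a) :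
    mixedPartial F (insert a v) = mixedPartial (coordDeriv a F) v := by
  ext z
  have hn : (v.sort (· ≤ ·)).length + 1 = (v.sort (· ≤ ·) ++ [a]).length := by simp
  rw [mixedPartial_eq_of_sort_eq F (sort_insert_max ha) hn,
    mixedPartial_eq_of_sort_eq _ rfl rfl, iteratedFDeriv_succ_apply_right]
  have hF' : ContDiff ℝ ∞ (fderiv ℝ F) := hF.fderiv_right (by simp)
  have hcomp := (ContinuousLinearMap.apply ℝ ℝ (Pi.single a 1 : Fin d → ℝ)).iteratedFDeriv_comp_left
    (hF'.contDiffAt (x := z)) (i := (v.sort (· ≤ ·)).length) (by exact_mod_cast le_top)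
  have heq : coordDeriv a F =
      ContinuousLinearMap.apply ℝ ℝ (Pi.single a 1 : Fin d → ℝ) ∘ fderiv ℝ F := rfl
  rw [heq, hcomp]
  have hget : ∀ k : Fin (v.sort (· ≤ ·)).length,
      (v.sort (· ≤ ·) ++ [a])[k.val]'(hn ▸ k.2.trans (Nat.lt_succ_self _)) = (v.sort (· ≤ ·))[k.val] :=
    fun k => List.getElem_append_left k.2
  simp [Fin.init_def, hget]

end MixedPartial

section SubsetGrowth

variable {d : ℕ}

/-- All mixed partial derivatives of `F` over subsets of `v` grow slowly. -/
def SubsetGrowth (v : Finset (Fin d)) (F : (Fin d → ℝ) → ℝ) : Prop :=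
  ∀ w ⊆ v, SlowGrowth (mixedPartial F w)

lemma subsetGrowth_empty_iff {F : (Fin d → ℝ) → ℝ} : SubsetGrowth ∅ F ↔ SlowGrowth F := by
  simp [SubsetGrowth, Finset.subset_empty, mixedPartial_empty]

lemma SubsetGrowth.mono {F : (Fin d → ℝ) → ℝ} {v w : Finset (Fin d)} (hF : SubsetGrowth v F)
    (h : w ⊆ v) : SubsetGrowth w F := fun u hu => hF u (hu.trans h)

lemma subsetGrowth_insert_max_iff {F : (Fin d → ℝ) → ℝ} (hF : ContDiff ℝ ∞ F)
    {v : Finset (Fin d)} {a : Fin d} (ha : ∀ b ∈ v, b < a) :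
    SubsetGrowth (insert a v) F ↔ SubsetGrowth v F ∧ SubsetGrowth v (coordDeriv a F) := by
  have hins : ∀ w ⊆ v, mixedPartial F (insert a w) = mixedPartial (coordDeriv a F) w :=
    fun w hw => mixedPartial_insert_max hF fun b hb => ha b (hw hb)
  refine ⟨fun h => ⟨h.mono (Finset.subset_insert a v), fun w hw => ?_⟩, fun h w hw => ?_⟩
  · rw [← hins w hw]
    exact h _ (Finset.insert_subset_insert a hw)
  · by_cases haw : a ∈ w
    · have hsub : w.erase a ⊆ v := Finset.subset_insert_iff.1 hw
      rw [← Finset.insert_erase haw, hins _ hsub]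
      exact h.2 _ hsub
    · exact h.1 w ((Finset.subset_insert_iff_of_notMem haw).1 hw)

lemma SubsetGrowth.add {F H : (Fin d → ℝ) → ℝ} {v : Finset (Fin d)} (hF : ContDiff ℝ ∞ F)
    (hH : ContDiff ℝ ∞ H) (hFv : SubsetGrowth v F) (hHv : SubsetGrowth v H) :
    SubsetGrowth v (fun z => F z + H z) := by
  intro w hw
  rw [mixedPartial_add hF hH]
  exact (hFv w hw).add (hHv w hw)

lemma SubsetGrowth.const (v : Finset (Fin d)) (c : ℝ) :
    SubsetGrowth v (fun _ : Fin d → ℝ => c) := by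
  induction v using Finset.induction_on_max generalizing c with
  | empty => exact subsetGrowth_empty_iff.2 (SlowGrowth.const c)
  | insert a v ha ih =>
    refine (subsetGrowth_insert_max_iff contDiff_const ha).2 ⟨ih c, ?_⟩
    have hzero : coordDeriv a (fun _ => c) = fun _ => 0 := by
      ext z
      simp [coordDeriv]
    rw [hzero]
    exact ih 0

lemma SubsetGrowth.mul {F H : (Fin d → ℝ) → ℝ} {v : Finset (Fin d)} (hF : ContDiff ℝ ∞ F)
    (hH : ContDiff ℝ ∞ H) (hFv : SubsetGrowth v F) (hHv : SubsetGrowth v H) :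
    SubsetGrowth v (fun z => F z * H z) := by
  induction v using Finset.induction_on_max generalizing F H with
  | empty =>
    rw [subsetGrowth_empty_iff] at *
    exact hFv.mul hHv
  | insert a v ha ih =>
    rw [subsetGrowth_insert_max_iff hF ha] at hFv
    rw [subsetGrowth_insert_max_iff hH ha] at hHv
    refine (subsetGrowth_insert_max_iff (hF.mul hH) ha).2 ⟨ih hF hH hFv.1 hHv.1, ?_⟩
    have hF' := contDiff_coordDeriv hF a
    have hH' := contDiff_coordDeriv hH a
    rw [coordDeriv_mul hF hH]
    exact SubsetGrowth.add (hF.mul hH') (hF'.mul hH) (ih hF hH' hFv.1 hHv.2)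
      (ih hF' hH hFv.2 hHv.1)

end SubsetGrowth

section Positivization

variable {η : ℝ}

lemma vplus_radicand_pos (hη : 0 < η) (t : ℝ) : 0 < η + t ^ 2 / 4 := by positivity

lemma abs_vplus_le (hη : 0 < η) (t : ℝ) : |vplus η t| ≤ |t| + √η := by
  have hsqrt : √(η + t ^ 2 / 4) ≤ √η + |t| / 2 := by
    refine Real.sqrt_le_iff.2 ⟨by positivity, ?_⟩
    nlinarith [Real.sq_sqrt hη.le, sq_abs t, mul_nonneg (Real.sqrt_nonneg η) (abs_nonneg t)]
  calc |vplus η t| ≤ |t / 2| + |√(η + t ^ 2 / 4)| := abs_add_le _ _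
    _ = |t| / 2 + √(η + t ^ 2 / 4) := by rw [abs_div, abs_two, abs_of_nonneg (Real.sqrt_nonneg _)]
    _ ≤ |t| + √η := by linarith

lemma contDiff_sqrt_radicand (hη : 0 < η) : ContDiff ℝ ∞ (fun t : ℝ => √(η + t ^ 2 / 4)) :=
  ContDiff.sqrt (by fun_prop) fun t => (vplus_radicand_pos hη t).ne'

lemma contDiff_vplus (hη : 0 < η) : ContDiff ℝ ∞ (vplus η) :=
  (contDiff_id.div_const 2).add (contDiff_sqrt_radicand hη)

lemma contDiff_inv_sqrt_radicand (hη : 0 < η) :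
    ContDiff ℝ ∞ (fun t : ℝ => (√(η + t ^ 2 / 4))⁻¹) :=
  (contDiff_sqrt_radicand hη).inv fun t => (Real.sqrt_pos.2 (vplus_radicand_pos hη t)).ne'

lemma hasDerivAt_sqrt_radicand (hη : 0 < η) (t : ℝ) :
    HasDerivAt (fun t : ℝ => √(η + t ^ 2 / 4)) (t / 4 * (√(η + t ^ 2 / 4))⁻¹) t := by
  have h : HasDerivAt (fun t : ℝ => η + t ^ 2 / 4) (t / 2) t := by
    convert! ((hasDerivAt_pow 2 t).div_const 4).const_add η using 1
    norm_num
    ring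
  convert! h.sqrt (vplus_radicand_pos hη t).ne' using 1
  field_simp
  norm_num

lemma hasDerivAt_vplus (hη : 0 < η) (t : ℝ) :
    HasDerivAt (vplus η) (1 / 2 * (vplus η t * (√(η + t ^ 2 / 4))⁻¹)) t := by
  have hs := (Real.sqrt_pos.2 (vplus_radicand_pos hη t)).ne'
  convert! ((hasDerivAt_id t).div_const 2).add (hasDerivAt_sqrt_radicand hη t) using 1
  unfold vplus
  field_simp
  ring

lemma hasDerivAt_inv_sqrt_radicand (hη : 0 < η) (t : ℝ) :
    HasDerivAt (fun t : ℝ => (√(η + t ^ 2 / 4))⁻¹)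
      (-1 / 4 * (t * ((√(η + t ^ 2 / 4))⁻¹ * ((√(η + t ^ 2 / 4))⁻¹ * (√(η + t ^ 2 / 4))⁻¹)))) t := by
  have hs := (Real.sqrt_pos.2 (vplus_radicand_pos hη t)).ne'
  convert! (hasDerivAt_sqrt_radicand hη t).inv hs using 1
  field_simp

variable {d : ℕ} {G : (Fin d → ℝ) → ℝ} {v : Finset (Fin d)}

lemma SubsetGrowth.inv_sqrt_radicand_comp (hη : 0 < η) (hG : ContDiff ℝ ∞ G)
    (hGv : SubsetGrowth v G) : SubsetGrowth v (fun z => (√(η + G z ^ 2 / 4))⁻¹) := by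
  have hu : ContDiff ℝ ∞ (fun z => (√(η + G z ^ 2 / 4))⁻¹) :=
    (contDiff_inv_sqrt_radicand hη).comp hG
  induction v using Finset.induction_on_max with
  | empty =>
    refine subsetGrowth_empty_iff.2 ((SlowGrowth.const (√η)⁻¹).mono fun z => ?_)
    rw [abs_of_nonneg (by positivity), abs_of_nonneg (by positivity)]
    gcongr
    exact le_add_of_nonneg_right (by positivity)
  | insert a v ha ih =>
    have hGa := (subsetGrowth_insert_max_iff hG ha).1 hGv
    have huv := ih hGa.1
    refine (subsetGrowth_insert_max_iff hu ha).2 ⟨huv, ?_⟩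
    rw [coordDeriv_comp (hasDerivAt_inv_sqrt_radicand hη) hG]
    refine SubsetGrowth.mul (contDiff_const.mul (hG.mul (hu.mul (hu.mul hu))))
      (contDiff_coordDeriv hG a) ?_ hGa.2
    refine SubsetGrowth.mul contDiff_const (hG.mul (hu.mul (hu.mul hu)))
      (SubsetGrowth.const v _) ?_
    exact SubsetGrowth.mul hG (hu.mul (hu.mul hu)) hGa.1
      (SubsetGrowth.mul hu (hu.mul hu) huv (SubsetGrowth.mul hu hu huv huv))

lemma SubsetGrowth.vplus_comp (hη : 0 < η) (hG : ContDiff ℝ ∞ G) (hGv : SubsetGrowth v G) :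
    SubsetGrowth v (fun z => vplus η (G z)) := by
  have hu : ContDiff ℝ ∞ (fun z => (√(η + G z ^ 2 / 4))⁻¹) :=
    (contDiff_inv_sqrt_radicand hη).comp hG
  have hp : ContDiff ℝ ∞ (fun z => vplus η (G z)) := (contDiff_vplus hη).comp hG
  induction v using Finset.induction_on_max with
  | empty =>
    rw [subsetGrowth_empty_iff] at *
    exact (hGv.abs.add (SlowGrowth.const √η)).mono fun z =>
      (abs_vplus_le hη (G z)).trans (le_abs_self _)
  | insert a v ha ih =>
    have hGa := (subsetGrowth_insert_max_iff hG ha).1 hGv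
    have hpv := ih hGa.1
    refine (subsetGrowth_insert_max_iff hp ha).2 ⟨hpv, ?_⟩
    rw [coordDeriv_comp (hasDerivAt_vplus hη) hG]
    refine SubsetGrowth.mul (contDiff_const.mul (hp.mul hu)) (contDiff_coordDeriv hG a) ?_ hGa.2
    exact SubsetGrowth.mul contDiff_const (hp.mul hu) (SubsetGrowth.const v _)
      (SubsetGrowth.mul hp hu hpv (SubsetGrowth.inv_sqrt_radicand_comp hη hG hGa.1))

end Positivization

/-- if `G̃` is smooth and satisfies the QMC-friendly boundary growth
condition, then so does `H(z) = v₊(G̃(z))` for any `η > 0`. -/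
theorem boundaryGrowth_vplus_comp
    {d : ℕ} (η : ℝ) (hη : 0 < η)
    (G : (Fin d → ℝ) → ℝ) (hG : ContDiff ℝ (⊤ : ℕ∞) G)
    (hb : BoundaryGrowthCondition G) :
    ContDiff ℝ (⊤ : ℕ∞) (fun z => vplus η (G z)) ∧
    BoundaryGrowthCondition (fun z => vplus η (G z)) := by
  refine ⟨(contDiff_vplus hη).comp hG, boundaryGrowthCondition_iff_slowGrowth.2 fun v => ?_⟩
  have hGv : SubsetGrowth v G := fun w _ => boundaryGrowthCondition_iff_slowGrowth.1 hb w
  exact SubsetGrowth.vplus_comp hη hG hGv v subset_rfl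
end
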